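/- arXiv:1901.05516 — 2 statements merged into one kernel-verified Lean document; each statement's English description precedes it below -/
import Mathlib

section
/- For each i ≥ 0 and 1 ≤ j ≤ ℓ there exist U_{(i,j),n} ∈ ℤ_p, for ⌈i/p⌉ ≤ n ≤ i, such that U_p(B_{ij}) = ∑_{n=⌈i/p⌉}^{i} U_{(i,j),n} · P̂_j^{np−i} · B^τ_{nj}, where B^τ_{nj} = 1/(x − P̂_j^p)^n (with B^τ_{n1} = x^n). For j = 1, 2 one has U_{(i,j),n} = 0 unless p divides i and n = i/p, in which case U_{(i,j),i/p} = 1. For j ≥ 3, U_{(i,j),⌈i/p⌉} is a p-adic unit, and ord_p U_{(i,j),n} ≥ (np − i)/(p − 1) − 1 for all n. -/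
open Polynomial

/-- The polynomials `W_i ∈ ℤ[t]` such that `p⁻¹ ∑_{v ^ p = y} (v - 1)⁻ⁱ = W_i ((y - 1)⁻¹)`. -/
noncomputable def traceInvPoly (p : ℕ) : ℕ → ℤ[X]
  | 0 => 1
  | i + 1 => X * ∑ k ∈ Finset.range p,
      C (p.choose (k + 1) : ℤ) * (if k < i then traceInvPoly p (i - k) else C ((-1) ^ (k - i)))
termination_by i => i
decreasing_by omega

theorem traceInvPoly_zero (p : ℕ) : traceInvPoly p 0 = 1 := by
  rw [traceInvPoly]

theorem traceInvPoly_succ (p i : ℕ) :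
    traceInvPoly p (i + 1) = X * ∑ k ∈ Finset.range p,
      C (p.choose (k + 1) : ℤ) *
        (if k < i then traceInvPoly p (i - k) else C ((-1) ^ (k - i))) := by
  rw [traceInvPoly]

theorem coeff_traceInvPoly_zero (p n : ℕ) :
    (traceInvPoly p 0).coeff n = if n = 0 then 1 else 0 := by
  rw [traceInvPoly_zero, coeff_one]

theorem coeff_traceInvPoly_succ_zero (p i : ℕ) : (traceInvPoly p (i + 1)).coeff 0 = 0 := by
  rw [traceInvPoly_succ, coeff_X_mul_zero]

theorem coeff_traceInvPoly_succ_succ (p i n : ℕ) :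
    (traceInvPoly p (i + 1)).coeff (n + 1) = ∑ k ∈ Finset.range p,
      (p.choose (k + 1) : ℤ) * (if k < i then (traceInvPoly p (i - k)).coeff n
        else if n = 0 then (-1) ^ (k - i) else 0) := by
  rw [traceInvPoly_succ, coeff_X_mul, finsetSum_coeff]
  refine Finset.sum_congr rfl fun k _ => ?_
  rw [coeff_C_mul]
  split_ifs with hk hn
  · rfl
  · rw [coeff_C, if_pos hn]
  · rw [coeff_C, if_neg hn]

theorem coeff_traceInvPoly_eq_zero (p i n : ℕ) (h : n * p < i ∨ i < n) :
    (traceInvPoly p i).coeff n = 0 := by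
  induction i using Nat.strong_induction_on generalizing n with
  | _ i ih =>
    rcases i with _ | i
    · rw [coeff_traceInvPoly_zero, if_neg (by omega)]
    rcases n with _ | n
    · exact coeff_traceInvPoly_succ_zero p i
    rw [coeff_traceInvPoly_succ_succ]
    refine Finset.sum_eq_zero fun k hk => ?_
    rw [Finset.mem_range] at hk
    rw [Nat.succ_mul] at h
    split_ifs with hki hn
    · rw [ih (i - k) (by omega) n (by omega), mul_zero]
    · subst hn
      omega
    · rw [mul_zero]

theorem not_dvd_coeff_traceInvPoly {p : ℕ} (hp : p.Prime) (i : ℕ) :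
    ¬ (p : ℤ) ∣ (traceInvPoly p i).coeff ((i + p - 1) / p) := by
  have hp1 := hp.one_lt
  induction i using Nat.strong_induction_on with
  | _ i ih =>
    rcases i with _ | i
    · rw [Nat.div_eq_of_lt (by omega), coeff_traceInvPoly_zero, if_pos rfl]
      intro h
      exact hp.one_lt.ne' (by simpa using Int.natAbs_dvd_natAbs.mpr h)
    have hn : (i + 1 + p - 1) / p = i / p + 1 := by
      rw [show i + 1 + p - 1 = i + p by omega, Nat.add_div_right _ hp.pos]
    obtain ⟨m, rfl⟩ : ∃ m, p = m + 1 := ⟨p - 1, by omega⟩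
    rw [hn, coeff_traceInvPoly_succ_succ, Finset.sum_range_succ]
    rw [dvd_add_right (Finset.dvd_sum fun k hk => Dvd.dvd.mul_right (Int.natCast_dvd_natCast.mpr
      (hp.dvd_choose_self (by omega) (by simpa using hk))) _)]
    rw [Nat.choose_self, Nat.cast_one, one_mul]
    split_ifs with hm hi
    · have := ih (i - m) (by omega)
      rwa [show i - m + (m + 1) - 1 = i by omega] at this
    · intro h
      have := Int.natAbs_dvd_natAbs.mpr h
      rw [Int.natAbs_natCast, Int.natAbs_pow, Int.natAbs_neg, Int.natAbs_one, one_pow] at this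
      exact hp1.ne' (Nat.dvd_one.mp this)
    · exact absurd (Nat.div_eq_of_lt (by omega)) hi

section Field

variable {K : Type*} [Field K] {p : ℕ} {ζ : K}

theorem sum_range_pow_mul_pow (hζ : IsPrimitiveRoot ζ p) (α : K) (i : ℕ) :
    ∑ k ∈ Finset.range p, (ζ ^ k * α) ^ i = if p ∣ i then (p : K) * α ^ i else 0 := by
  have h : ∀ k, (ζ ^ k * α) ^ i = (ζ ^ i) ^ k * α ^ i := fun k => by
    rw [mul_pow, ← pow_mul, ← pow_mul, mul_comm k i]
  simp_rw [h, ← Finset.sum_mul]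
  split_ifs with hi
  · simp [(hζ.pow_eq_one_iff_dvd i).mpr hi]
  · have h1 : ζ ^ i - 1 ≠ 0 := sub_ne_zero.mpr fun h => hi ((hζ.pow_eq_one_iff_dvd i).mp h)
    have h2 := geom_sum_mul (ζ ^ i) p
    rw [← pow_mul, mul_comm i p, pow_mul, hζ.pow_eq_one, one_pow, sub_self] at h2
    rw [(mul_eq_zero.mp h2).resolve_right h1, zero_mul]

theorem sum_range_pow_mul_sub_one_pow (hζ : IsPrimitiveRoot ζ p) (α : K) {m : ℕ} (hm : m < p) :
    ∑ k ∈ Finset.range p, (ζ ^ k * α - 1) ^ m = p * (-1) ^ m := by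
  simp_rw [sub_eq_add_neg, add_pow]
  rw [Finset.sum_comm]
  simp_rw [← Finset.sum_mul, sum_range_pow_mul_pow hζ]
  rw [Finset.sum_eq_single 0]
  · simp
  · intro b hb hb0
    rw [if_neg fun h => ?_, zero_mul, zero_mul]
    have := Nat.le_of_dvd (Nat.pos_of_ne_zero hb0) h
    rw [Finset.mem_range] at hb
    omega
  · simp

theorem inv_sub_one_pow_succ {v : K} (hv : v ^ p ≠ 1) (i : ℕ) :
    ((v - 1)⁻¹) ^ (i + 1) = (v ^ p - 1)⁻¹ * ∑ k ∈ Finset.range p, (p.choose (k + 1) : K) *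
      (if k < i then ((v - 1)⁻¹) ^ (i - k) else (v - 1) ^ (k - i)) := by
  have hv1 : v - 1 ≠ 0 := by
    intro h
    rw [sub_eq_zero.mp h, one_pow] at hv
    exact hv rfl
  have key : v ^ p - 1 = ∑ k ∈ Finset.range p, (p.choose (k + 1) : K) * (v - 1) ^ (k + 1) := by
    have h := add_pow (v - 1) 1 p
    rw [sub_add_cancel, Finset.sum_range_succ'] at h
    rw [h]
    simp [mul_comm]
  rw [eq_inv_mul_iff_mul_eq₀ (sub_ne_zero.mpr hv), key, Finset.sum_mul]
  refine Finset.sum_congr rfl fun k _ => ?_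
  rw [mul_assoc]
  congr 1
  rw [inv_pow]
  split_ifs with hk
  · obtain ⟨d, rfl⟩ := Nat.exists_eq_add_of_lt hk
    rw [show k + d + 1 - k = d + 1 by omega, inv_pow]
    field_simp
    ring
  · obtain ⟨d, rfl⟩ := Nat.exists_eq_add_of_le (not_lt.mp hk)
    rw [show i + d - i = d by omega]
    field_simp
    ring

theorem sum_range_inv_pow_mul_sub_one (hζ : IsPrimitiveRoot ζ p) {α : K} (hα : α ^ p ≠ 1)
    (i : ℕ) :
    ∑ k ∈ Finset.range p, ((ζ ^ k * α - 1)⁻¹) ^ i =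
      p * (traceInvPoly p i).eval₂ (Int.castRingHom K) (α ^ p - 1)⁻¹ := by
  induction i using Nat.strong_induction_on with
  | _ i ih =>
    rcases i with _ | i
    · simp [traceInvPoly_zero]
    have hpow : ∀ k, (ζ ^ k * α) ^ p = α ^ p := fun k => by
      rw [mul_pow, ← pow_mul, mul_comm k p, pow_mul, hζ.pow_eq_one, one_pow, one_mul]
    have h : ∀ k, ((ζ ^ k * α - 1)⁻¹) ^ (i + 1) = _ := fun k =>
      inv_sub_one_pow_succ (p := p) (v := ζ ^ k * α) (by rwa [hpow]) i
    simp_rw [h, hpow]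
    rw [← Finset.mul_sum, Finset.sum_comm, traceInvPoly_succ, eval₂_mul, eval₂_X,
      eval₂_finsetSum, mul_left_comm, Finset.mul_sum _ _ (p : K)]
    congr 1
    refine Finset.sum_congr rfl fun m hm => ?_
    rw [Finset.mem_range] at hm
    rw [← Finset.mul_sum, eval₂_mul, eval₂_C, mul_left_comm]
    congr 1
    · simp
    split_ifs with hmi
    · exact ih _ (by omega)
    · rw [sum_range_pow_mul_sub_one_pow hζ α (by omega), eval₂_C]
      simp

end Field

section Norm

variable {K : Type*} [NormedField K] [IsUltrametricDist K] {p : ℕ}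

theorem norm_intCast_eq_one_of_not_dvd (hp : p.Prime) (hpK : ‖(p : K)‖ < 1) {n : ℤ}
    (hn : ¬ (p : ℤ) ∣ n) : ‖(n : K)‖ = 1 := by
  refine le_antisymm (IsUltrametricDist.norm_intCast_le_one K n) ?_
  by_contra! hlt
  obtain ⟨u, v, huv⟩ := (Prime.coprime_iff_not_dvd (Nat.prime_iff_prime_int.mp hp)).mpr hn
  have h1 : (1 : K) = u * p + v * n := by exact_mod_cast congrArg (Int.cast (R := K)) huv.symm
  have h2 : ‖(1 : K)‖ < 1 := by
    rw [h1]
    refine (IsUltrametricDist.norm_add_le_max _ _).trans_lt (max_lt ?_ ?_)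
    · rw [norm_mul]
      exact (mul_le_of_le_one_left (norm_nonneg _)
        (IsUltrametricDist.norm_intCast_le_one K u)).trans_lt hpK
    · rw [norm_mul]
      exact (mul_le_of_le_one_left (norm_nonneg _)
        (IsUltrametricDist.norm_intCast_le_one K v)).trans_lt hlt
  simp at h2

theorem norm_choose_le_inv (hp : p.Prime) (hpK : ‖(p : K)‖ = (p : ℝ)⁻¹) {k : ℕ} (hk0 : k ≠ 0)
    (hk : k < p) : ‖(p.choose k : K)‖ ≤ (p : ℝ)⁻¹ := by
  obtain ⟨c, hc⟩ := hp.dvd_choose_self hk0 hk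
  rw [hc, Nat.cast_mul, norm_mul, hpK]
  exact mul_le_of_le_one_right (by positivity) (IsUltrametricDist.norm_natCast_le_one K c)

theorem norm_coeff_traceInvPoly_le (hp : p.Prime) (hpK : ‖(p : K)‖ = (p : ℝ)⁻¹) (i n : ℕ) :
    ‖((traceInvPoly p i).coeff n : K)‖ ≤ (p : ℝ) ^ (1 - ((n : ℝ) * p - i) / ((p : ℝ) - 1)) := by
  have hp1 : (1 : ℝ) < p := by exact_mod_cast hp.one_lt
  have hp0 : (0 : ℝ) < p := by linarith
  have hpm : (0 : ℝ) < (p : ℝ) - 1 := by linarith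
  induction i using Nat.strong_induction_on generalizing n with
  | _ i ih =>
    rcases i with _ | i
    · rw [coeff_traceInvPoly_zero]
      split_ifs with h
      · subst h
        simpa using hp1.le
      · simpa using Real.rpow_nonneg hp0.le _
    rcases n with _ | n
    · rw [coeff_traceInvPoly_succ_zero]
      simpa using Real.rpow_nonneg hp0.le _
    rw [coeff_traceInvPoly_succ_succ, Int.cast_sum]
    refine IsUltrametricDist.norm_sum_le_of_forall_le_of_nonneg (Real.rpow_nonneg hp0.le _)
      fun k hk => ?_
    rw [Finset.mem_range] at hk
    rw [Int.cast_mul, Int.cast_natCast, norm_mul]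
    split_ifs with hki hn
    · have hih := ih (i - k) (by omega) n
      rw [Nat.cast_sub hki.le] at hih
      rcases (show k + 1 ≤ p by omega).lt_or_eq with hkp | hkp
      · refine (mul_le_mul (norm_choose_le_inv hp hpK (by omega) hkp) hih (norm_nonneg _)
          (by positivity)).trans ?_
        rw [← Real.rpow_neg_one, ← Real.rpow_add hp0]
        refine Real.rpow_le_rpow_of_exponent_le hp1.le ?_
        have : ((n + 1 : ℕ) * p - (i + 1 : ℕ) : ℝ) / ((p : ℝ) - 1) =
            (n * p - (i - k)) / ((p : ℝ) - 1) + (p - 1 - k) / ((p : ℝ) - 1) := by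
          push_cast
          ring
        rw [this]
        have h2 : ((p : ℝ) - 1 - k) / ((p : ℝ) - 1) ≤ 1 := by
          rw [div_le_one hpm]
          have : (0 : ℝ) ≤ k := by positivity
          linarith
        linarith
      · refine (mul_le_of_le_one_left (norm_nonneg _)
          (IsUltrametricDist.norm_natCast_le_one K _)).trans (hih.trans_eq ?_)
        have : (p : ℝ) = k + 1 := by exact_mod_cast hkp.symm
        congr 3
        push_cast
        rw [this]
        ring
    · have h1 : (1 : ℝ) ≤ (p : ℝ) ^ (1 - (((n + 1 : ℕ) : ℝ) * p - (i + 1 : ℕ)) / ((p : ℝ) - 1)) := by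
        refine Real.one_le_rpow hp1.le ?_
        rw [sub_nonneg, div_le_one hpm, hn]
        push_cast
        have : (0 : ℝ) ≤ i := by positivity
        linarith
      refine le_trans (mul_le_one₀ (IsUltrametricDist.norm_natCast_le_one K _) (norm_nonneg _)
        (IsUltrametricDist.norm_intCast_le_one K _)) h1
    · simpa using Real.rpow_nonneg hp0.le _

end Norm

/--
action of the Dwork operator `U_p` on the basis `B_{ij}`.
`K` is an (abstract) `ℂ_p`: a complete algebraically closed nonarchimedean normed field
with `‖p‖ = 1/p`.  The `z j` are the Teichmüller lifts `P̂_j` (index `j = 0`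
corresponding to `P₁ = ∞`, `j = 1` to `P₂ = 0`).  `B (i,j) = 1/(x - P̂_j)ⁱ` (with
`B (i,0) = xⁱ`), `Bτ (n,j) = 1/(x - P̂_jᵖ)ⁿ` and `(U_p ξ)(x) = p⁻¹ ∑_{w^p = x} ξ(w)`.
Then there exist `U_{(i,j),n} ∈ ℤ_p` (for `⌈i/p⌉ ≤ n ≤ i`) with
`U_p(B_{ij}) = ∑_{n=⌈i/p⌉}^i U_{(i,j),n} P̂_j^{np-i} Bτ_{nj}` on the affinoid; for
`j = 1, 2` one has `U_{(i,j),n} = 0` unless `p ∣ i` and `n = i/p`, in which case it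
is `1`; for `j ≥ 3`, `U_{(i,j),⌈i/p⌉}` is a `p`-adic unit and
`ord_p U_{(i,j),n} ≥ (np - i)/(p-1) - 1`, i.e. `‖U_{(i,j),n}‖ ≤ p^{1 - (np-i)/(p-1)}`.
-/
theorem Up_on_basis
    {K : Type*} [NormedField K] [CompleteSpace K] [IsAlgClosed K]
    (p : ℕ) (hp : p.Prime) (a : ℕ) (ha : 1 ≤ a) (q : ℕ) (hq : q = p ^ a)
    (hna : ∀ x y : K, ‖x + y‖ ≤ max ‖x‖ ‖y‖)
    (hpK : ‖(p : K)‖ = (p : ℝ)⁻¹)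
    (ℓ : ℕ) (hℓ : 2 ≤ ℓ)
    (z : Fin ℓ → K)
    (hzq : ∀ j, z j ^ q = z j)
    (hz1 : ∀ j : Fin ℓ, (j : ℕ) = 1 → z j = 0)
    (hzne : ∀ j : Fin ℓ, 2 ≤ (j : ℕ) → z j ≠ 0)
    (hzinj : ∀ j k : Fin ℓ, (j : ℕ) ≠ 0 → (k : ℕ) ≠ 0 → z j = z k → j = k)
    (r : ℝ) (hr0 : 0 < r) (hr1 : r < 1)
    -- the Dwork operator
    (Up : (K → K) → (K → K))
    (hUp : ∀ (ξ : K → K) (x : K),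
      Up ξ x = (p : K)⁻¹ * ((Polynomial.X ^ p - Polynomial.C x).roots.map ξ).sum)
    -- the bases B_{ij} and Bτ_{nj}
    (B Bτ : ℕ × Fin ℓ → K → K)
    (hB : ∀ i (j : Fin ℓ) (x : K),
      B (i, j) x = if (j : ℕ) = 0 then x ^ i else ((x - z j)⁻¹) ^ i)
    (hBτ : ∀ n (j : Fin ℓ) (x : K),
      Bτ (n, j) x = if (j : ℕ) = 0 then x ^ n else ((x - (z j) ^ p)⁻¹) ^ n)
    (i : ℕ) (j : Fin ℓ) :
    ∃ U : ℕ → K,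
      -- the coefficients lie in ℤ_p = closure of ℤ in K
      (∀ n, U n ∈ closure (Set.range ((↑) : ℤ → K))) ∧
      -- the expansion of U_p(B_{ij}), valid on the affinoid 𝔸_{r^p, sp}
      (∀ x : K, ‖x‖ ≤ (r ^ p)⁻¹ → (∀ k : Fin ℓ, (k : ℕ) ≠ 0 → r ^ p ≤ ‖x - (z k) ^ p‖) →
        Up (B (i, j)) x =
          ∑ n ∈ Finset.Icc ((i + p - 1) / p) i,
            U n * (if (j : ℕ) = 0 then 1 else z j ^ (n * p - i)) * Bτ (n, j) x) ∧
      -- for j = 1, 2 (indices 0, 1)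
      ((j : ℕ) < 2 →
        (∀ n, ¬(p ∣ i ∧ n = i / p) → U n = 0) ∧ (p ∣ i → U (i / p) = 1)) ∧
      -- for j ≥ 3 (indices ≥ 2)
      (2 ≤ (j : ℕ) →
        ‖U ((i + p - 1) / p)‖ = 1 ∧
        ∀ n, n ≤ i → ‖U n‖ ≤
          (p : ℝ) ^ (-((((n * p - i : ℕ) : ℝ)) / ((p : ℝ) - 1) - 1))) := by
  have : IsUltrametricDist K := IsUltrametricDist.isUltrametricDist_of_forall_norm_add_le_max_norm hna
  have hp1 : (1 : ℝ) < p := by exact_mod_cast hp.one_lt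
  have hp0 : (p : K) ≠ 0 := by
    rw [← norm_pos_iff, hpK]
    positivity
  have hpK1 : ‖(p : K)‖ < 1 := hpK ▸ inv_lt_one_of_one_lt₀ hp1
  have : NeZero (p : K) := ⟨hp0⟩
  have : NeZero p := ⟨hp.ne_zero⟩
  obtain ⟨ζ, hζ⟩ := HasEnoughRootsOfUnity.exists_primitiveRoot K p
  have hUp' : ∀ (ξ : K → K) (β : K),
      Up ξ (β ^ p) = (p : K)⁻¹ * ∑ k ∈ Finset.range p, ξ (ζ ^ k * β) := by
    intro ξ β
    rw [hUp, ← Polynomial.nthRoots, hζ.nthRoots_eq rfl, Multiset.map_map]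
    rfl
  have hroot : ∀ x : K, ∃ β, β ^ p = x := fun x => IsAlgClosed.exists_pow_nat_eq x hp.pos
  have hceil : ∀ n, (i + p - 1) / p ≤ n ↔ i ≤ n * p := fun n => by
    have := hp.pos
    rw [Nat.div_le_iff_le_mul_add_pred hp.pos, mul_comm p n]
    omega
  have hdiv : p ∣ i → i / p ∈ Finset.Icc ((i + p - 1) / p) i := fun h => by
    rw [Finset.mem_Icc, hceil, Nat.div_mul_cancel h]
    exact ⟨le_rfl, Nat.div_le_self _ _⟩
  by_cases hj2 : (j : ℕ) < 2
  · refine ⟨fun n => if p ∣ i ∧ n = i / p then 1 else 0, fun n => subset_closure ?_, ?_,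
      fun _ => ⟨fun n hn => if_neg hn, fun h => if_pos ⟨h, rfl⟩⟩, fun h => by omega⟩
    · dsimp only
      split_ifs
      exacts [⟨1, by simp⟩, ⟨0, by simp⟩]
    intro x _ _
    obtain ⟨β, rfl⟩ := hroot x
    rw [hUp']
    simp only [hB, hBτ]
    by_cases hj0 : (j : ℕ) = 0
    · simp only [hj0, if_true, mul_one, ite_mul, one_mul, zero_mul]
      rw [sum_range_pow_mul_pow hζ]
      by_cases hi : p ∣ i
      · rw [Finset.sum_eq_single_of_mem _ (hdiv hi) fun b _ hb => if_neg fun h => hb h.2,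
          if_pos hi, if_pos ⟨hi, rfl⟩, inv_mul_cancel_left₀ hp0, ← pow_mul, Nat.mul_div_cancel' hi]
      · simp [hi]
    · have hzj : z j = 0 := hz1 j (by omega)
      simp only [hj0, if_false, hzj, sub_zero, zero_pow hp.ne_zero, mul_inv, ← inv_pow]
      rw [sum_range_pow_mul_pow hζ.inv]
      by_cases hi : p ∣ i
      · rw [Finset.sum_eq_single_of_mem _ (hdiv hi) fun b _ hb => by
            rw [if_neg fun h => hb h.2, zero_mul, zero_mul],
          if_pos hi, if_pos ⟨hi, rfl⟩, inv_mul_cancel_left₀ hp0, Nat.div_mul_cancel hi, ← pow_mul,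
          Nat.mul_div_cancel' hi]
        simp
      · simp [hi]
  · have hj0 : (j : ℕ) ≠ 0 := by omega
    have hzj : z j ≠ 0 := hzne j (by omega)
    refine ⟨fun n => ((traceInvPoly p i).coeff n : K), fun n => subset_closure ⟨_, rfl⟩, ?_,
      fun h => absurd h hj2, fun _ => ⟨?_, fun n _ => ?_⟩⟩
    · intro x _ hx
      obtain ⟨β, hβ⟩ := hroot (x / z j ^ p)
      obtain rfl : (z j * β) ^ p = x := by
        rw [mul_pow, hβ, mul_div_cancel₀ _ (pow_ne_zero _ hzj)]
      have hβ1 : β ^ p ≠ 1 := by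
        intro h
        have := hx j hj0
        rw [mul_pow, h, mul_one, sub_self, norm_zero] at this
        exact absurd this (not_le.mpr (pow_pos hr0 p))
      rw [hUp']
      simp only [hB, hBτ, hj0, if_false]
      have h1 : ∀ k, ((ζ ^ k * (z j * β) - z j)⁻¹) ^ i =
          ((z j)⁻¹) ^ i * ((ζ ^ k * β - 1)⁻¹) ^ i := fun k => by
        rw [← mul_pow, ← mul_inv]
        congr 2
        ring
      simp_rw [h1]
      rw [← Finset.mul_sum, sum_range_inv_pow_mul_sub_one hζ hβ1, mul_left_comm,
        inv_mul_cancel_left₀ hp0, eval₂_eq_sum, Polynomial.sum_def, Finset.mul_sum]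
      refine (Finset.sum_subset_zero_on_sdiff ?_ ?_ ?_)
      · intro n hn
        rw [Finset.mem_Icc, hceil]
        rw [mem_support_iff] at hn
        by_contra hcon
        exact hn (coeff_traceInvPoly_eq_zero p i n (by omega))
      · intro n hn
        rw [Finset.mem_sdiff, notMem_support_iff] at hn
        rw [hn.2, Int.cast_zero, zero_mul, zero_mul]
      · intro n hn
        have hin : i ≤ n * p := by
          by_contra hcon
          exact mem_support_iff.mp hn (coeff_traceInvPoly_eq_zero p i n (by omega))
        have h2 : (z j * β) ^ p - z j ^ p = z j ^ p * (β ^ p - 1) := by ring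
        have h3 : z j ^ (n * p - i) * (((z j) ^ p)⁻¹) ^ n = ((z j)⁻¹) ^ i := by
          rw [pow_sub₀ _ hzj hin, inv_pow, ← pow_mul, mul_comm p n, inv_pow, mul_right_comm,
            mul_inv_cancel₀ (pow_ne_zero _ hzj), one_mul]
        rw [h2, mul_inv, mul_pow, ← h3, eq_intCast]
        ring
    · exact norm_intCast_eq_one_of_not_dvd hp hpK1 (not_dvd_coeff_traceInvPoly hp i)
    · dsimp only
      rcases le_or_gt i (n * p) with h | h
      · refine (norm_coeff_traceInvPoly_le hp hpK i n).trans_eq ?_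
        rw [Nat.cast_sub h, Nat.cast_mul, neg_sub]
      · rw [coeff_traceInvPoly_eq_zero p i n (Or.inl h), Int.cast_zero, norm_zero]
        positivity
end

section
/- Let t_1,…,t_m be distinct elements of 𝔽_q with Teichmüller lifts t̂_1,…,t̂_m ∈ ℂ_p, and set v(x) = ∏_{i=1}^m (x − t̂_i). Then for every x ∈ ℂ_p with |x|_p ≤ 1 and |x − t̂_i|_p = 1 for all i, and every integer b ≥ 0, one has |v(x)^{(q−1)p^b} − (v(x^q)/v(x))^{p^b}|_p ≤ p^{−(b+1)}. -/
theorem natCast_dvd_prod_sub_pow_sub {R ι : Type*} [CommRing R] {p : ℕ} (hp : p.Prime) (a : ℕ)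
    (s : Finset ι) (t : ι → R) (ht : ∀ i ∈ s, t i ^ p ^ a = t i) (x : R) :
    (p : R) ∣ (∏ i ∈ s, (x - t i)) ^ p ^ a - ∏ i ∈ s, (x ^ p ^ a - t i) := by
  rw [← Ideal.mem_span_singleton, ← Ideal.Quotient.eq, ← Finset.prod_pow, map_prod, map_prod]
  refine Finset.prod_congr rfl fun i hi => ?_
  rw [Ideal.Quotient.eq, Ideal.mem_span_singleton]
  obtain ⟨r, hr⟩ := exists_add_pow_prime_pow_eq hp (x - t i) (t i) a
  rw [sub_add_cancel, ht i hi] at hr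
  exact ⟨-((x - t i) * t i * r), by rw [hr]; ring⟩

/-- The closed unit ball of a nonarchimedean normed field, as a subring. -/
def closedUnitBallSubring (K : Type*) [NormedField K]
    (hna : ∀ x y : K, ‖x + y‖ ≤ max ‖x‖ ‖y‖) : Subring K where
  carrier := {x | ‖x‖ ≤ 1}
  mul_mem' {x y} hx hy :=
    (norm_mul x y).trans_le (mul_le_one₀ hx (norm_nonneg y) hy)
  one_mem' := by simp
  add_mem' {x y} hx hy := (hna x y).trans (max_le hx hy)
  zero_mem' := by simp
  neg_mem' {x} hx := by simpa using hx


/--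
Reich's congruence. Let `t 1, …, t m` be (the Teichmüller lifts of)
distinct elements of `𝔽_q` inside a nonarchimedean field `K` (so `t i ^ q = t i` and `t`
is injective), and set `v x = ∏ i (x - t i)`.  Then for every `x` with `‖x‖ ≤ 1` and
`‖x - t i‖ = 1` for all `i`, and every `b ≥ 0`,
`‖v x ^ ((q-1) p^b) - (v (x^q) / v x) ^ (p^b)‖ ≤ p^{-(b+1)}`.
-/
theorem reich_congruence
    {K : Type*} [NormedField K]
    (p : ℕ) (hp : p.Prime) (a : ℕ) (ha : 1 ≤ a) (q : ℕ) (hq : q = p ^ a)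
    (hna : ∀ x y : K, ‖x + y‖ ≤ max ‖x‖ ‖y‖)
    (hpK : ‖(p : K)‖ = (p : ℝ)⁻¹)
    (m : ℕ) (t : Fin m → K)
    (ht : ∀ i, (t i) ^ q = t i)
    (htinj : Function.Injective t)
    (v : K → K) (hv : ∀ x, v x = ∏ i, (x - t i))
    (x : K) (hx1 : ‖x‖ ≤ 1) (hx2 : ∀ i, ‖x - t i‖ = 1) (b : ℕ) :
    ‖(v x) ^ ((q - 1) * p ^ b) - (v (x ^ q) / v x) ^ (p ^ b)‖ ≤ ((p : ℝ)⁻¹) ^ (b + 1) := by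
  subst hq
  have hq1 : 1 ≤ p ^ a := Nat.one_le_pow _ _ hp.pos
  let O := closedUnitBallSubring K hna
  have htO (i) : t i ∈ O := by
    have h := hna x (-(x - t i))
    rw [norm_neg, hx2 i, show x + -(x - t i) = t i by ring] at h
    exact h.trans (max_le hx1 le_rfl)
  let y : O := ⟨x, hx1⟩
  let s : Fin m → O := fun i => ⟨t i, htO i⟩
  have hdvd := dvd_sub_pow_of_dvd_sub (natCast_dvd_prod_sub_pow_sub hp a Finset.univ s
    (fun i _ => Subtype.ext (ht i)) y) b
  obtain ⟨c, hc⟩ := hdvd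
  replace hc := congrArg O.subtype hc
  simp only [map_sub, map_pow, map_prod, map_mul, map_natCast] at hc
  change ((∏ i, (x - t i)) ^ p ^ a) ^ p ^ b - (∏ i, (x ^ p ^ a - t i)) ^ p ^ b
    = (p : K) ^ (b + 1) * (c : K) at hc
  rw [← hv, ← hv] at hc
  have hvx : ‖v x‖ = 1 := by simp [hv, hx2]
  have hv0 : v x ≠ 0 := norm_ne_zero_iff.mp (by rw [hvx]; exact one_ne_zero)
  have key : v x ^ ((p ^ a - 1) * p ^ b) - (v (x ^ p ^ a) / v x) ^ p ^ b
      = (p : K) ^ (b + 1) * (c : K) / v x ^ p ^ b := by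
    rw [← hc, sub_div, div_pow, ← div_pow (v x ^ p ^ a) (v x), pow_mul, pow_sub₀ _ hv0 hq1,
      pow_one, div_eq_mul_inv (v x ^ p ^ a)]
  rw [key, norm_div, norm_mul, norm_pow, norm_pow, hvx, one_pow, div_one, hpK]
  exact mul_le_of_le_one_right (by positivity) c.2
end
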